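/- arXiv:1209.0070 — 2 statements merged into one kernel-verified Lean document; each statement's English description precedes it below -/
import Mathlib

section
/- (Caratheodory existence theorem) Let t₀ ∈ ℝ, δ > 0, β > 0, c₀ ∈ ℝⁿ, and let K = {c ∈ ℝⁿ : |c − c₀| ≤ β}. Let F : [t₀−δ, t₀+δ] × K → ℝⁿ satisfy: (i) for every c ∈ K, the map t ↦ F(t,c) is measurable; (ii) for almost every t ∈ [t₀−δ, t₀+δ], the map c ↦ F(t,c) is continuous; (iii) there exists an integrable function G : [t₀−δ, t₀+δ] → ℝ such that |F_i(t,c)| ≤ G(t) for all (t,c) ∈ [t₀−δ, t₀+δ] × K and all i = 1,…,n. Then there exist δ' ∈ (0,δ) and a continuous function c : [t₀−δ', t₀+δ'] → K with c(t₀) = c₀ such that c(t) = c₀ + ∫_{t₀}^{t} F(s, c(s)) ds for all t ∈ [t₀−δ', t₀+δ']; in particular c is differentiable at almost every t with c'(t) = F(t, c(t)). -/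
open MeasureTheory Set Filter Topology

/-- Move `t` towards `t₀` by `ε`, stopping at `t₀`. -/
def delay (t₀ ε t : ℝ) : ℝ := t - max (-ε) (min (t - t₀) ε)

lemma continuous_delay (t₀ ε : ℝ) : Continuous (delay t₀ ε) := by
  unfold delay; fun_prop

lemma abs_delay_sub_delay_le {t₀ ε : ℝ} (s t : ℝ) :
    |delay t₀ ε s - delay t₀ ε t| ≤ |s - t| := by
  unfold delay; grind

lemma abs_delay_sub_self_le {t₀ ε : ℝ} (hε : 0 ≤ ε) (t : ℝ) : |delay t₀ ε t - t| ≤ ε := by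
  unfold delay; grind

lemma abs_delay_sub_le {t₀ ε r t : ℝ} (hε : 0 ≤ ε) (hr : 0 ≤ r) (ht : |t - t₀| ≤ r + ε) :
    |delay t₀ ε t - t₀| ≤ r := by
  unfold delay; grind

lemma delay_mem_Icc {t₀ ε a t : ℝ} (hε : 0 ≤ ε) (ht : t ∈ Icc (t₀ - a) (t₀ + a)) :
    delay t₀ ε t ∈ Icc (t₀ - a) (t₀ + a) := by
  simp only [mem_Icc] at *; unfold delay; grind

section Caratheodory

variable {E : Type*} [NormedAddCommGroup E] {f : ℝ → E → E} {g : ℝ → ℝ} {u : ℝ → E}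

/-- A Carathéodory function composed with a measurable function is measurable. -/
lemma aestronglyMeasurable_caratheodory_comp
    (hmeas : ∀ x, AEStronglyMeasurable (fun t => f t x) volume)
    (hcont : ∀ᵐ t, Continuous (f t)) (hu : StronglyMeasurable u) :
    AEStronglyMeasurable (fun t => f t (u t)) volume := by
  have happrox : ∀ k, AEStronglyMeasurable (fun t => f t (hu.approx k t)) volume := by
    intro k
    have heq : (fun t => f t (hu.approx k t)) = fun t =>
        ∑ x ∈ (hu.approx k).range, (hu.approx k ⁻¹' {x}).indicator (fun t => f t x) t := by
      funext t
      rw [Finset.sum_eq_single (hu.approx k t)]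
      · simp
      · intro x _ hx
        exact indicator_of_notMem (fun h => hx h.symm) _
      · intro h
        exact absurd (SimpleFunc.mem_range_self _ t) h
    rw [heq]
    exact Finset.aestronglyMeasurable_fun_sum _ fun x _ =>
      (hmeas x).indicator (SimpleFunc.measurableSet_fiber _ _)
  refine aestronglyMeasurable_of_tendsto_ae atTop happrox ?_
  filter_upwards [hcont] with t ht
  exact (ht.tendsto _).comp (hu.tendsto_approx t)

lemma integrable_caratheodory_comp
    (hmeas : ∀ x, AEStronglyMeasurable (fun t => f t x) volume)
    (hcont : ∀ᵐ t, Continuous (f t)) (hg : Integrable g) (hb : ∀ t x, ‖f t x‖ ≤ g t)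
    (hu : StronglyMeasurable u) : Integrable fun t => f t (u t) :=
  hg.mono' (aestronglyMeasurable_caratheodory_comp hmeas hcont hu)
    (Eventually.of_forall fun _ => hb _ _)

variable [NormedSpace ℝ E]

lemma norm_integral_caratheodory_le (hg : Integrable g) (hb : ∀ t x, ‖f t x‖ ≤ g t)
    (p q : ℝ) : ‖∫ s in p..q, f s (u s)‖ ≤ |∫ s in p..q, g s| :=
  intervalIntegral.norm_integral_le_abs_of_norm_le (Eventually.of_forall fun _ => hb _ _)
    hg.intervalIntegrable

/-- Tonelli's approximate solutions of the integral equation. -/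
lemma exists_delayed_solution
    (hmeas : ∀ x, AEStronglyMeasurable (fun t => f t x) volume)
    (hcont : ∀ᵐ t, Continuous (f t)) (hg : Integrable g) (hb : ∀ t x, ‖f t x‖ ≤ g t)
    (x₀ : E) (t₀ a : ℝ) {ε : ℝ} (hε : 0 < ε) :
    ∃ u : ℝ → E, Continuous u ∧ ∀ t ∈ Icc (t₀ - a) (t₀ + a),
      u t = x₀ + ∫ s in t₀..delay t₀ ε t, f s (u s) := by
  let T : (ℝ → E) → ℝ → E := fun u t => x₀ + ∫ s in t₀..delay t₀ ε t, f s (u s)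
  have hTc : ∀ u, Continuous u → Continuous (T u) := fun u hu =>
    continuous_const.add (((integrable_caratheodory_comp hmeas hcont hg hb
      hu.stronglyMeasurable).continuous_primitive t₀).comp (continuous_delay t₀ ε))
  have hc : ∀ m, Continuous (T^[m] fun _ => x₀) := by
    intro m
    induction m with
    | zero => exact continuous_const
    | succ m ih => rw [Function.iterate_succ_apply']; exact hTc _ ih
  have hfix : ∀ m : ℕ, ∀ t, |t - t₀| ≤ m * ε →
      (T^[m] fun _ => x₀) t = T (T^[m] fun _ => x₀) t := by
    intro m
    induction m with
    | zero =>
      intro t ht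
      have ht : t = t₀ := by simpa [sub_eq_zero] using ht
      have : delay t₀ ε t = t₀ := by unfold delay; grind
      simp [T, this]
    | succ m ih =>
      intro t ht
      rw [Function.iterate_succ_apply']
      have hd : |delay t₀ ε t - t₀| ≤ m * ε :=
        abs_delay_sub_le hε.le (by positivity) (by push_cast at ht; linarith)
      change x₀ + _ = x₀ + _
      congr 1
      refine intervalIntegral.integral_congr fun s hs => ?_
      rw [← ih s ((abs_sub_left_of_mem_uIcc hs).trans hd)]
  obtain ⟨m, hm⟩ := exists_nat_ge (a / ε)
  refine ⟨_, hc m, fun t ht => hfix m t ?_⟩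
  rw [div_le_iff₀ hε] at hm
  exact (abs_le.2 ⟨by linarith [ht.1], by linarith [ht.2]⟩).trans hm

/-- Global version of the Carathéodory existence theorem, on a prescribed compact interval. -/
lemma exists_solution_of_caratheodory [FiniteDimensional ℝ E]
    (hmeas : ∀ x, AEStronglyMeasurable (fun t => f t x) volume)
    (hcont : ∀ᵐ t, Continuous (f t)) (hg : Integrable g) (hb : ∀ t x, ‖f t x‖ ≤ g t)
    (x₀ : E) (t₀ : ℝ) {a : ℝ} (ha : 0 ≤ a) :
    ∃ u : ℝ → E, Continuous u ∧ ∀ t ∈ Icc (t₀ - a) (t₀ + a),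
      u t = x₀ + ∫ s in t₀..t, f s (u s) := by
  have : ProperSpace E := FiniteDimensional.proper ℝ E
  have hle : t₀ - a ≤ t₀ + a := by linarith
  obtain ⟨ε, -, hε, hε0⟩ := exists_seq_strictAnti_tendsto (0 : ℝ)
  choose u huc hu using fun k => exists_delayed_solution hmeas hcont hg hb x₀ t₀ a (hε k)
  have hΓ : Continuous fun t => ∫ s in t₀..t, g s := hg.continuous_primitive t₀
  have hdiff : ∀ (v : ℝ → E), Continuous v → ∀ p q,
      ‖(∫ s in t₀..p, f s (v s)) - ∫ s in t₀..q, f s (v s)‖ ≤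
        dist (∫ s in t₀..p, g s) (∫ s in t₀..q, g s) := by
    intro v hv p q
    have hi := integrable_caratheodory_comp hmeas hcont hg hb hv.stronglyMeasurable
    rw [intervalIntegral.integral_interval_sub_left hi.intervalIntegrable hi.intervalIntegrable,
      Real.dist_eq, intervalIntegral.integral_interval_sub_left hg.intervalIntegrable
        hg.intervalIntegrable]
    exact norm_integral_caratheodory_le hg hb _ _
  let w : ℕ → BoundedContinuousFunction (Icc (t₀ - a) (t₀ + a)) E := fun k =>
    BoundedContinuousFunction.mkOfCompact ⟨fun t => u k t, (huc k).comp continuous_subtype_val⟩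
  have hequi : Equicontinuous ((↑) : range w → Icc (t₀ - a) (t₀ + a) → E) := by
    refine UniformEquicontinuous.equicontinuous (Metric.uniformEquicontinuous_iff.2 ?_)
    intro η hη
    obtain ⟨r, hr, hru⟩ := Metric.uniformContinuousOn_iff.1
      (isCompact_Icc.uniformContinuousOn_of_continuous hΓ.continuousOn) η hη
    refine ⟨r, hr, ?_⟩
    rintro x y hxy ⟨_, k, rfl⟩
    change dist (u k x) (u k y) < η
    rw [hu k x x.2, hu k y y.2, dist_add_left, dist_eq_norm]
    refine (hdiff _ (huc k) _ _).trans_lt (hru _ (delay_mem_Icc (hε k).le x.2) _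
      (delay_mem_Icc (hε k).le y.2) ?_)
    exact (abs_delay_sub_delay_le _ _).trans_lt hxy
  have hball : ∀ (v : BoundedContinuousFunction (Icc (t₀ - a) (t₀ + a)) E)
      (x : Icc (t₀ - a) (t₀ + a)), v ∈ range w → v x ∈ Metric.closedBall x₀ (∫ s, g s) := by
    rintro _ x ⟨k, rfl⟩
    change u k x ∈ _
    have hg0 : ∀ s, 0 ≤ g s := fun s => (norm_nonneg _).trans (hb s x₀)
    rw [hu k x x.2, mem_closedBall_iff_norm, add_sub_cancel_left]
    refine (norm_integral_caratheodory_le hg hb _ _).trans ?_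
    rw [intervalIntegral.abs_integral_eq_abs_integral_uIoc,
      abs_of_nonneg (integral_nonneg hg0)]
    exact setIntegral_le_integral hg (Eventually.of_forall hg0)
  obtain ⟨v, -, φ, hφ, hlim⟩ :=
    (BoundedContinuousFunction.arzela_ascoli _ (isCompact_closedBall x₀ (∫ s, g s)) _ hball
      hequi).tendsto_subseq fun k => subset_closure (mem_range_self k)
  have hptw : ∀ x : Icc (t₀ - a) (t₀ + a), Tendsto (fun k => u (φ k) x) atTop (𝓝 (v x)) :=
    fun x => ((BoundedContinuousFunction.tendsto_iff_tendstoUniformly.1 hlim).tendsto_at x)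
  have hc : Continuous (IccExtend hle v) := v.continuous.Icc_extend'
  refine ⟨IccExtend hle v, hc, fun t ht => ?_⟩
  have hptw' : ∀ s ∈ Icc (t₀ - a) (t₀ + a),
      Tendsto (fun k => u (φ k) s) atTop (𝓝 (IccExtend hle v s)) := by
    intro s hs
    rw [IccExtend_of_mem _ _ hs]
    exact hptw ⟨s, hs⟩
  have ht₀ : t₀ ∈ Icc (t₀ - a) (t₀ + a) := ⟨by linarith, by linarith⟩
  have hint : Tendsto (fun k => ∫ s in t₀..t, f s (u (φ k) s)) atTop
      (𝓝 (∫ s in t₀..t, f s (IccExtend hle v s))) := by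
    refine intervalIntegral.tendsto_integral_filter_of_dominated_convergence g
      (Eventually.of_forall fun k => (aestronglyMeasurable_caratheodory_comp hmeas hcont
        (huc _).stronglyMeasurable).restrict)
      (Eventually.of_forall fun k => Eventually.of_forall fun s _ => hb _ _)
      hg.intervalIntegrable ?_
    filter_upwards [hcont] with s hs hst
    exact (hs.tendsto _).comp
      (hptw' s (uIcc_subset_Icc ht₀ ht (uIoc_subset_uIcc hst)))
  have hdelay : Tendsto (fun k => delay t₀ (ε (φ k)) t) atTop (𝓝 t) := by
    rw [tendsto_iff_dist_tendsto_zero]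
    exact squeeze_zero (fun _ => dist_nonneg) (fun k => abs_delay_sub_self_le (hε _).le t)
      (hε0.comp hφ.tendsto_atTop)
  have herr : Tendsto (fun k => (∫ s in t₀..delay t₀ (ε (φ k)) t, f s (u (φ k) s)) -
      ∫ s in t₀..t, f s (u (φ k) s)) atTop (𝓝 0) :=
    squeeze_zero_norm (fun k => hdiff _ (huc _) _ _)
      (tendsto_iff_dist_tendsto_zero.1 ((hΓ.tendsto t).comp hdelay))
  have hsum := (herr.add hint).const_add x₀
  simp only [sub_add_cancel, zero_add] at hsum
  refine tendsto_nhds_unique (hptw' t ht) (hsum.congr fun k => (hu _ t ht).symm)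

end Caratheodory


/-- Caratheodory existence theorem: if `F : [t₀-δ, t₀+δ] × K → ℝⁿ` (with
`K = {c : |c - c₀| ≤ β}` the Euclidean closed ball) is measurable in `t`, continuous in `c`
for a.e. `t`, and componentwise dominated by an integrable function `G`, then the integral
equation `c(t) = c₀ + ∫_{t₀}^t F(s, c(s)) ds` has a continuous solution with values in `K`
on some interval `[t₀-δ', t₀+δ']`; in particular `c' = F(t, c(t))` for a.e. `t` there. -/
theorem caratheodory_existence {n : ℕ} (t₀ δ β : ℝ) (hδ : 0 < δ) (hβ : 0 < β)
    (c₀ : Fin n → ℝ) (F : ℝ → (Fin n → ℝ) → (Fin n → ℝ))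
    (K : Set (Fin n → ℝ))
    (hK : K = {c : Fin n → ℝ | Real.sqrt (∑ i, (c i - c₀ i) ^ 2) ≤ β})
    (hmeas : ∀ c ∈ K, AEMeasurable (fun t => F t c) (volume.restrict (Icc (t₀ - δ) (t₀ + δ))))
    (hcont : ∀ᵐ t ∂(volume.restrict (Icc (t₀ - δ) (t₀ + δ))), ContinuousOn (fun c => F t c) K)
    (hdom : ∃ G : ℝ → ℝ, IntegrableOn G (Icc (t₀ - δ) (t₀ + δ)) ∧
      ∀ t ∈ Icc (t₀ - δ) (t₀ + δ), ∀ c ∈ K, ∀ i : Fin n, |F t c i| ≤ G t) :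
    ∃ δ' ∈ Ioo (0 : ℝ) δ, ∃ c : ℝ → (Fin n → ℝ),
      ContinuousOn c (Icc (t₀ - δ') (t₀ + δ')) ∧
      (∀ t ∈ Icc (t₀ - δ') (t₀ + δ'), c t ∈ K) ∧
      c t₀ = c₀ ∧
      (∀ t ∈ Icc (t₀ - δ') (t₀ + δ'), c t = c₀ + ∫ s in t₀..t, F s (c s)) ∧
      (∀ᵐ t ∂(volume.restrict (Icc (t₀ - δ') (t₀ + δ'))), HasDerivAt c (F t (c t)) t) := by
  obtain ⟨G, hG, hFG⟩ := hdom
  set I := Icc (t₀ - δ) (t₀ + δ) with hI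
  have hKnhds : K ∈ 𝓝 c₀ := by
    have hN : Continuous fun c : Fin n → ℝ => Real.sqrt (∑ i, (c i - c₀ i) ^ 2) := by fun_prop
    rw [hK]
    filter_upwards [(hN.tendsto c₀).eventually_lt_const (u := β) (by simpa using hβ)] with c hc
    exact hc.le
  obtain ⟨η, hη, hball⟩ := Metric.nhds_basis_closedBall.mem_iff.1 hKnhds
  let lo : Fin n → ℝ := fun i => c₀ i - η
  let hi : Fin n → ℝ := fun i => c₀ i + η
  have hlohi : lo ≤ hi := fun i => by simp only [lo, hi]; linarith
  have hbox : Icc lo hi ⊆ K := fun x hx => hball <| by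
    rw [Metric.mem_closedBall, dist_pi_le_iff hη.le]
    intro i
    have h1 := hx.1 i
    have h2 := hx.2 i
    simp only [lo, hi] at h1 h2
    rw [Real.dist_eq, abs_le]
    constructor <;> linarith
  -- the coordinatewise retraction onto a box contained in `K`
  let P : (Fin n → ℝ) → Fin n → ℝ := fun x => lo ⊔ (x ⊓ hi)
  have hPc : Continuous P := continuous_pi fun i =>
    continuous_const.sup ((continuous_apply i).inf continuous_const)
  have hPK : ∀ x, P x ∈ K := fun x => hbox ⟨le_sup_left, sup_le hlohi inf_le_right⟩
  have hPid : ∀ x ∈ Icc lo hi, P x = x := fun x hx => by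
    simp only [P]
    rw [inf_eq_left.2 hx.2, sup_eq_right.2 hx.1]
  let f : ℝ → (Fin n → ℝ) → Fin n → ℝ := fun t x => I.indicator (fun t => F t (P x)) t
  have hfmeas : ∀ x, AEStronglyMeasurable (fun t => f t x) volume := fun x =>
    (aestronglyMeasurable_indicator_iff measurableSet_Icc).2
      (hmeas _ (hPK x)).aestronglyMeasurable
  have hfcont : ∀ᵐ t, Continuous (f t) := by
    rw [ae_restrict_iff' measurableSet_Icc] at hcont
    filter_upwards [hcont] with t ht
    by_cases htI : t ∈ I
    · have : f t = fun x => F t (P x) := funext fun x => indicator_of_mem htI _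
      rw [this]
      exact (ht htI).comp_continuous hPc hPK
    · have : f t = fun _ => 0 := funext fun x => indicator_of_notMem htI _
      rw [this]
      exact continuous_const
  have hgint : Integrable (I.indicator fun t => |G t|) :=
    (integrable_indicator_iff measurableSet_Icc).2 hG.abs
  have hfb : ∀ t x, ‖f t x‖ ≤ I.indicator (fun t => |G t|) t := by
    intro t x
    simp only [f, norm_indicator_eq_indicator_norm]
    refine indicator_le_indicator' fun htI => ?_
    exact (pi_norm_le_iff_of_nonneg (abs_nonneg _)).2 fun i =>
      (hFG t htI _ (hPK x) i).trans (le_abs_self _)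
  obtain ⟨c, hc, hceq⟩ := exists_solution_of_caratheodory hfmeas hfcont hgint hfb c₀ t₀ hδ.le
  have hct₀ : c t₀ = c₀ := by
    rw [hceq t₀ ⟨by linarith, by linarith⟩]
    simp
  have hboxnhds : Icc lo hi ∈ 𝓝 (c t₀) := by
    rw [hct₀]
    exact pi_Icc_mem_nhds (fun i => by simp [lo, hη]) (fun i => by simp [hi, hη])
  obtain ⟨r, hr, hrbox⟩ := Metric.nhds_basis_closedBall.mem_iff.1
    (hc.continuousAt.preimage_mem_nhds hboxnhds)
  rw [Real.closedBall_eq_Icc] at hrbox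
  obtain ⟨δ', hδ'0, hδ'⟩ := exists_between (lt_min hr hδ)
  obtain ⟨hδ'r, hδ'δ⟩ := lt_min_iff.1 hδ'
  have hcbox : ∀ t ∈ Icc (t₀ - δ') (t₀ + δ'), c t ∈ Icc lo hi := fun t ht =>
    hrbox ⟨by linarith [ht.1], by linarith [ht.2]⟩
  have hsub : Icc (t₀ - δ') (t₀ + δ') ⊆ Ioo (t₀ - δ) (t₀ + δ) := fun t ht =>
    ⟨by linarith [ht.1], by linarith [ht.2]⟩
  have hfF : ∀ t ∈ Icc (t₀ - δ') (t₀ + δ'), f t (c t) = F t (c t) := fun t ht => by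
    simp only [f]
    rw [indicator_of_mem (Ioo_subset_Icc_self (hsub ht)), hPid _ (hcbox t ht)]
  refine ⟨δ', ⟨hδ'0, hδ'δ⟩, c, hc.continuousOn, fun t ht => hbox (hcbox t ht), hct₀, ?_, ?_⟩
  · intro t ht
    rw [hceq t (Ioo_subset_Icc_self (hsub ht))]
    congr 1
    refine intervalIntegral.integral_congr fun s hs => hfF s ?_
    exact uIcc_subset_Icc ⟨by linarith, by linarith⟩ ht hs
  · rw [ae_restrict_iff' measurableSet_Icc]
    filter_upwards [LocallyIntegrable.ae_hasDerivAt_integral (integrable_caratheodory_comp hfmeas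
      hfcont hgint hfb hc.stronglyMeasurable).locallyIntegrable] with t hderiv ht
    rw [← hfF t ht]
    refine ((hderiv t₀).const_add c₀).congr_of_eventuallyEq ?_
    filter_upwards [isOpen_Ioo.mem_nhds (hsub ht)] with s hs
    exact hceq s (Ioo_subset_Icc_self hs)
end

section
/- Let n ≥ 1, r ∈ [1,2], λ ∈ [0,1], θ ∈ (0,1) and b > 0, and define g : M^{n×n} → M^{n×n} by g(D) = (b/(1−θ))(μ(|D|²) − θ)D, where μ(s) = 1 − λ + λ(1+s)^{(r−2)/2}. Then g is globally Lipschitz: there exists L > 0 such that |g(A) − g(B)| ≤ L|A − B| for all A, B ∈ M^{n×n}. -/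
attribute [local instance] Matrix.frobeniusNormedAddCommGroup Matrix.frobeniusNormedSpace

/-- The map `g(D) = (b/(1-θ)) (μ(|D|²) - θ) D`, with
`μ(s) = 1 - λ + λ (1+s)^((r-2)/2)`, on `n × n` real matrices with the Frobenius norm. -/
noncomputable def oldroydG {n : ℕ} (b θ lam r : ℝ)
    (D : Matrix (Fin n) (Fin n) ℝ) : Matrix (Fin n) (Fin n) ℝ :=
  (b / (1 - θ) * ((1 - lam + lam * (1 + ‖D‖ ^ 2) ^ ((r - 2) / 2)) - θ)) • D

/-- If `f` takes values in `[0, 1]` and is antitone while `t ↦ t * f t` is monotone on `[0, ∞)`,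
then the radial map `x ↦ f ‖x‖ • x` is `2`-Lipschitz. -/
theorem norm_radial_smul_sub_le {E : Type*} [NormedAddCommGroup E] [NormedSpace ℝ E] {f : ℝ → ℝ}
    (f_nonneg : ∀ t, 0 ≤ t → 0 ≤ f t) (f_le_one : ∀ t, 0 ≤ t → f t ≤ 1)
    (f_anti : AntitoneOn f (Set.Ici 0)) (f_mono : MonotoneOn (fun t ↦ t * f t) (Set.Ici 0))
    (x y : E) : ‖f ‖x‖ • x - f ‖y‖ • y‖ ≤ 2 * ‖x - y‖ := by
  wlog hxy : ‖x‖ ≤ ‖y‖ generalizing x y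
  · rw [norm_sub_rev, norm_sub_rev x]
    exact this y x (le_of_not_ge hxy)
  have hx := norm_nonneg x
  have hy := norm_nonneg y
  have anti : f ‖y‖ ≤ f ‖x‖ := f_anti hx hy hxy
  have mono : ‖x‖ * f ‖x‖ ≤ ‖y‖ * f ‖y‖ := f_mono hx hy hxy
  have h0 := f_nonneg _ hy
  have h1 := f_le_one _ hy
  have hsub : ‖y‖ - ‖x‖ ≤ ‖x - y‖ := norm_sub_rev x y ▸ norm_sub_norm_le y x
  calc ‖f ‖x‖ • x - f ‖y‖ • y‖ = ‖f ‖y‖ • (x - y) + (f ‖x‖ - f ‖y‖) • x‖ := by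
        congr 1; module
    _ ≤ ‖f ‖y‖ • (x - y)‖ + ‖(f ‖x‖ - f ‖y‖) • x‖ := norm_add_le _ _
    _ = f ‖y‖ * ‖x - y‖ + (f ‖x‖ - f ‖y‖) * ‖x‖ := by
        rw [norm_smul, norm_smul, Real.norm_of_nonneg h0, Real.norm_of_nonneg (sub_nonneg.2 anti)]
    _ ≤ 2 * ‖x - y‖ := by
        nlinarith [mul_le_mul_of_nonneg_right h1 (norm_nonneg (x - y)),
          mul_le_mul_of_nonneg_right h1 (sub_nonneg.2 hxy)]

theorem antitoneOn_one_add_sq_rpow {p : ℝ} (hp : p ≤ 0) :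
    AntitoneOn (fun t : ℝ ↦ (1 + t ^ 2) ^ p) (Set.Ici 0) := fun s _ t _ hst ↦
  Real.rpow_le_rpow_of_nonpos (by positivity) (by gcongr) hp

theorem monotoneOn_mul_one_add_sq_rpow {p : ℝ} (hp : -(1 / 2) ≤ p) :
    MonotoneOn (fun t : ℝ ↦ t * (1 + t ^ 2) ^ p) (Set.Ici 0) := by
  intro s hs t ht hst
  rw [Set.mem_Ici] at hs ht
  have factor (u : ℝ) : u * (1 + u ^ 2) ^ p = u / √(1 + u ^ 2) * (1 + u ^ 2) ^ (p + 1 / 2) := by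
    have hu : 0 < 1 + u ^ 2 := by positivity
    rw [Real.rpow_add hu, ← Real.sqrt_eq_rpow]
    field_simp
  have hdiv : s / √(1 + s ^ 2) ≤ t / √(1 + t ^ 2) := by
    rw [div_le_div_iff₀ (by positivity) (by positivity)]
    refine le_of_sq_le_sq ?_ (by positivity)
    rw [mul_pow, mul_pow, Real.sq_sqrt (by positivity), Real.sq_sqrt (by positivity)]
    nlinarith
  simp only [factor]
  have hp' : 0 ≤ p + 1 / 2 := by linarith
  gcongr

/-- For `r ∈ [1,2]`, `λ ∈ [0,1]`, `θ ∈ (0,1)` and `b > 0`, the map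
`g(D) = (b/(1-θ))(μ(|D|²) - θ)D` with `μ(s) = 1 - λ + λ(1+s)^((r-2)/2)`
is globally Lipschitz on `n × n` matrices with the Frobenius norm. -/
theorem oldroydG_lipschitz {n : ℕ} (r lam θ b : ℝ)
    (hr : r ∈ Set.Icc (1 : ℝ) 2) (hlam : lam ∈ Set.Icc (0 : ℝ) 1)
    (hθ : θ ∈ Set.Ioo (0 : ℝ) 1) (hb : 0 < b) :
    ∃ L > 0, ∀ A B : Matrix (Fin n) (Fin n) ℝ,
      ‖oldroydG b θ lam r A - oldroydG b θ lam r B‖ ≤ L * ‖A - B‖ := by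
  have hp : (r - 2) / 2 ≤ 0 := by linarith [hr.2]
  have radial (A B : Matrix (Fin n) (Fin n) ℝ) :=
    norm_radial_smul_sub_le (f := fun t ↦ (1 + t ^ 2) ^ ((r - 2) / 2))
      (fun t _ ↦ by positivity)
      (fun t _ ↦ Real.rpow_le_one_of_one_le_of_nonpos (by nlinarith [sq_nonneg t]) hp)
      (antitoneOn_one_add_sq_rpow hp)
      (monotoneOn_mul_one_add_sq_rpow (by linarith [hr.1])) A B
  set c := b / (1 - θ)
  refine ⟨|c * (1 - lam - θ)| + |c * lam| * 2 + 1, by positivity, fun A B ↦ ?_⟩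
  have split (D : Matrix (Fin n) (Fin n) ℝ) : oldroydG b θ lam r D =
      (c * (1 - lam - θ)) • D + (c * lam) • ((1 + ‖D‖ ^ 2) ^ ((r - 2) / 2) • D) := by
    rw [oldroydG]; module
  rw [split, split, add_sub_add_comm, ← smul_sub, ← smul_sub]
  refine (norm_add_le _ _).trans ?_
  rw [norm_smul, norm_smul, Real.norm_eq_abs, Real.norm_eq_abs]
  nlinarith [mul_le_mul_of_nonneg_left (radial A B) (abs_nonneg (c * lam)), norm_nonneg (A - B)]
end
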